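/- Let x ∈ D, γ ∈ [0,1], s ∈ argmin_{s'∈D} ⟨s', ∇f(x)⟩, and y := x + γ(s − x). Then h_D(y) ≤ (1 − γ) h_D(x) + (γ²/2) C_f^D, where h_D(z) := f(z) − min_{z'∈D} f(z'). -/

import Mathlib

/-- A convex function lies above its tangent hyperplanes. -/
theorem ConvexOn.add_fderiv_sub_le {E : Type*} [NormedAddCommGroup E] [NormedSpace ℝ E]
    {f : E → ℝ} (hf : ConvexOn ℝ Set.univ f) {x : E} (hx : DifferentiableAt ℝ f x) (w : E) :
    f x + fderiv ℝ f x (w - x) ≤ f w := by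
  have hg : ConvexOn ℝ Set.univ (f ∘ AffineMap.lineMap (k := ℝ) x w) := by
    simpa using hf.comp_affineMap (AffineMap.lineMap (k := ℝ) x w)
  have hd : HasDerivAt (f ∘ AffineMap.lineMap (k := ℝ) x w) (fderiv ℝ f x (w - x)) 0 := by
    refine HasFDerivAt.comp_hasDerivAt (0 : ℝ) ?_ AffineMap.hasDerivAt_lineMap
    simpa using hx.hasFDerivAt
  have h := hg.le_slope_of_hasDerivAt (Set.mem_univ 0) (Set.mem_univ 1) zero_lt_one hd
  simp only [slope_def_field, Function.comp_apply, AffineMap.lineMap_apply_zero,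
    AffineMap.lineMap_apply_one, sub_zero, div_one] at h
  linarith

/-- One-step progress bound for Frank–Wolfe: if `x ∈ D`, `γ ∈ [0,1]`,
`s ∈ argmin_{s' ∈ D} ⟨s', ∇f(x)⟩` and `y = x + γ(s − x)`, then
`h_D(y) ≤ (1 − γ) h_D(x) + (γ²/2) C_f^D`, where `h_D(z) = f(z) − min_{z' ∈ D} f(z')`,
`D = {x : Ω x ≤ τ}`, and the curvature constant `C_f^D` (assumed finite) is the
supremum defining set below. -/
theorem stmt8 (N : ℕ) (Ω : (Fin N → ℝ) → ℝ)
    (hΩadd : ∀ a b, Ω (a + b) ≤ Ω a + Ω b)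
    (hΩsmul : ∀ (c : ℝ) (a), Ω (c • a) = |c| * Ω a)
    (hΩdef : ∀ a, Ω a = 0 ↔ a = 0)
    (τ : ℝ) (hτ : 0 < τ)
    (f : (Fin N → ℝ) → ℝ) (hconv : ConvexOn ℝ Set.univ f) (hdiff : Differentiable ℝ f)
    -- curvature constant assumed finite
    (hC : BddAbove {c : ℝ | ∃ a b γ', Ω a ≤ τ ∧ Ω b ≤ τ ∧ γ' ∈ Set.Icc (0 : ℝ) 1 ∧
        c = 2 / γ' ^ 2 *
          (f (a + γ' • (b - a)) - f a - fderiv ℝ f a (γ' • (b - a)))})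
    (x s : Fin N → ℝ) (γ : ℝ)
    (hx : Ω x ≤ τ) (hs : Ω s ≤ τ) (hγ : γ ∈ Set.Icc (0 : ℝ) 1)
    -- s ∈ argmin_{s' ∈ D} ⟨s', ∇f(x)⟩
    (hopt : ∀ s', Ω s' ≤ τ → fderiv ℝ f x s ≤ fderiv ℝ f x s') :
    f (x + γ • (s - x)) - sInf {v : ℝ | ∃ w, Ω w ≤ τ ∧ v = f w}
      ≤ (1 - γ) * (f x - sInf {v : ℝ | ∃ w, Ω w ≤ τ ∧ v = f w}) +
        γ ^ 2 / 2 *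
          sSup {c : ℝ | ∃ a b γ', Ω a ≤ τ ∧ Ω b ≤ τ ∧ γ' ∈ Set.Icc (0 : ℝ) 1 ∧
            c = 2 / γ' ^ 2 *
              (f (a + γ' • (b - a)) - f a - fderiv ℝ f a (γ' • (b - a)))} := by
  set m := sInf {v : ℝ | ∃ w, Ω w ≤ τ ∧ v = f w}
  set C := sSup {c : ℝ | ∃ a b γ', Ω a ≤ τ ∧ Ω b ≤ τ ∧ γ' ∈ Set.Icc (0 : ℝ) 1 ∧
    c = 2 / γ' ^ 2 * (f (a + γ' • (b - a)) - f a - fderiv ℝ f a (γ' • (b - a)))}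
  obtain rfl | hpos := hγ.1.eq_or_lt
  · simp
  have hgap : f x + fderiv ℝ f x (s - x) ≤ m := by
    refine le_csInf ⟨f x, x, hx, rfl⟩ ?_
    rintro _ ⟨w, hw, rfl⟩
    have h := hconv.add_fderiv_sub_le (hdiff x) w
    rw [map_sub] at h ⊢
    linarith [hopt w hw]
  have hcurv : 2 / γ ^ 2 * (f (x + γ • (s - x)) - f x - fderiv ℝ f x (γ • (s - x))) ≤ C :=
    le_csSup hC ⟨x, s, γ, hx, hs, hγ, rfl⟩
  have hstep : f (x + γ • (s - x)) - f x - fderiv ℝ f x (γ • (s - x)) ≤ γ ^ 2 / 2 * C := by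
    calc _ = γ ^ 2 / 2 *
          (2 / γ ^ 2 * (f (x + γ • (s - x)) - f x - fderiv ℝ f x (γ • (s - x)))) := by
          field_simp
      _ ≤ _ := by gcongr
  rw [map_smul, smul_eq_mul] at hstep
  linarith [mul_le_mul_of_nonneg_left hgap hpos.le]
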